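/- arXiv:2601.03934 — 2 statements merged into one kernel-verified Lean document; each statement's English description precedes it below -/
import Mathlib

section
/- Let ρ be an in-port oblivious local forwarding pattern for a network G = (V, E) with target t, let F be a failure scenario, and let v be a vertex with v ≠ t such that ρ forwards from v under F along the edge e = {v, u} for some neighbor u of v with u ≠ t (that is, the constant value of ρ_v^F is e and e ∉ F). Define F' = F ∪ (local(u) ∖ {e}). If v is connected to t in the graph (V, E ∖ F'), then ρ is not perfectly resilient for t. -/
open Classical

namespace FRR

variable {V : Type*}

/-- A forwarding function: given a failure scenario, the current vertex and an in-port,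
return the link along which the packet is forwarded. -/
abbrev Fwd (V : Type*) := Set (Sym2 V) → V → Sym2 V → Sym2 V

/-- `ρ` is a forwarding pattern for `G`: at each vertex it returns an incident link
(or the self-loop `s(v, v)`, which models staying at `v`), and whenever not all
incident links have failed, the returned link is active (not failed). -/
def IsFwdPattern (G : SimpleGraph V) (ρ : Fwd V) : Prop :=
  ∀ F ⊆ G.edgeSet, ∀ (v : V) (e : Sym2 V),
    ρ F v e ∈ G.incidenceSet v ∪ {s(v, v)} ∧
    (¬ G.incidenceSet v ⊆ F → ρ F v e ∉ F)

/-- `ρ` is local: its decisions only depend on the locally visible failed links. -/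
def IsLocal (G : SimpleGraph V) (ρ : Fwd V) : Prop :=
  ∀ F ⊆ G.edgeSet, ∀ F' ⊆ G.edgeSet, ∀ v : V,
    F ∩ G.incidenceSet v = F' ∩ G.incidenceSet v → ∀ e : Sym2 V, ρ F v e = ρ F' v e

/-- `ρ` is in-port oblivious: at every vertex and in every failure scenario its
decision does not depend on the in-port. -/
def InPortOblivious (G : SimpleGraph V) (ρ : Fwd V) : Prop :=
  ∀ F ⊆ G.edgeSet, ∀ (v : V) (e e' : Sym2 V), ρ F v e = ρ F v e'

/-- The endpoint of `e` other than `v` (or `v` itself if `v ∉ e`). -/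
noncomputable def step (v : V) (e : Sym2 V) : V :=
  if h : v ∈ e then Sym2.Mem.other h else v

/-- `route ρ F s₀ n = (π_n, π_{n+1})` where `π` is the routing determined by `ρ`,
the start vertex `s₀` and the failure scenario `F`; that is, `π_0 = π_1 = s₀`
(injection is modeled by the in-port `s(s₀, s₀)`) and
`ρ_{π_i}^F s(π_{i-1}, π_i) = s(π_i, π_{i+1})` for `i ≥ 1`. -/
noncomputable def route (ρ : Fwd V) (F : Set (Sym2 V)) (s₀ : V) : ℕ → V × V
  | 0 => (s₀, s₀)
  | n + 1 =>
    ((route ρ F s₀ n).2,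
      step (route ρ F s₀ n).2
        (ρ F (route ρ F s₀ n).2 s((route ρ F s₀ n).1, (route ρ F s₀ n).2)))

/-- The routing determined by `ρ`, `s₀` and `F` reaches `t`. -/
def Reaches (ρ : Fwd V) (F : Set (Sym2 V)) (s₀ t : V) : Prop :=
  ∃ n : ℕ, (route ρ F s₀ n).1 = t

/-- `ρ` is perfectly resilient for the target `t` in `G`: for every failure scenario
and every start vertex still connected to `t` after the failures, the routing
reaches `t`. -/
def PerfectlyResilient (G : SimpleGraph V) (ρ : Fwd V) (t : V) : Prop :=
  ∀ F ⊆ G.edgeSet, ∀ v : V, (G.deleteEdges F).Reachable v t → Reaches ρ F v t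

/-- `L` is a skipping priority list for `G`: for every vertex and every in-port it is
a duplicate-free enumeration of all links incident to the vertex. -/
def IsSkipList (G : SimpleGraph V) (L : V → Sym2 V → List (Sym2 V)) : Prop :=
  ∀ (v : V) (e : Sym2 V), (L v e).Nodup ∧ ∀ f : Sym2 V, f ∈ L v e ↔ f ∈ G.incidenceSet v

/-- The skipping forwarding pattern induced by a skipping priority list: forward
along the first link of the list that is not failed (staying at `v`, modeled by the
self-loop `s(v, v)`, if all incident links failed). -/
noncomputable def skipFwd (L : V → Sym2 V → List (Sym2 V)) : Fwd V :=
  fun F v e =>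
    match (L v e).find? (fun f => decide (f ∉ F)) with
    | some f => f
    | none => s(v, v)

end FRR

namespace FRR

theorem step_mk_left {V : Type*} (a b : V) : step a s(a, b) = b := by
  have h : a ∈ s(a, b) := Sym2.mem_mk_left a b
  rw [step, dif_pos h]
  exact Sym2.congr_right.1 (Sym2.other_spec h)

/-- A set of vertices containing the start vertex and closed under forwarding steps
contains the whole routing. -/
theorem route_mem {V : Type*} {ρ : Fwd V} {F : Set (Sym2 V)} {S : Set V} {s₀ : V}
    (hs : s₀ ∈ S) (hstep : ∀ w ∈ S, ∀ e : Sym2 V, step w (ρ F w e) ∈ S) (n : ℕ) :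
    (route ρ F s₀ n).1 ∈ S ∧ (route ρ F s₀ n).2 ∈ S := by
  induction n with
  | zero => exact ⟨hs, hs⟩
  | succ n ih => exact ⟨ih.2, hstep _ ih.2 _⟩

end FRR

open FRR in
/-- Let `ρ` be an in-port oblivious local forwarding pattern for `G` with target
`t`, `F` a failure scenario and `v ≠ t` a vertex whose (in-port independent)
forwarding decision under `F` is the active link `e = s(v, u)` to a neighbor
`u ≠ t`.  Let `F'` extend `F` by all links incident to `u` other than `e`.
If `v` is still connected to `t` after the failures `F'`, then `ρ` is not
perfectly resilient for `t`. -/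
theorem not_perfectly_resilient_of_bounce {V : Type*} [Fintype V]
    (G : SimpleGraph V) (t : V) (ρ : Fwd V)
    (hρ : IsFwdPattern G ρ) (hloc : IsLocal G ρ) (hob : InPortOblivious G ρ)
    (F : Set (Sym2 V)) (hF : F ⊆ G.edgeSet)
    (v u : V) (hvt : v ≠ t) (hut : u ≠ t) (hadj : G.Adj v u)
    (hval : ∀ e' : Sym2 V, ρ F v e' = s(v, u)) (heF : s(v, u) ∉ F)
    (hreach : (G.deleteEdges (F ∪ (G.incidenceSet u \ {s(v, u)}))).Reachable v t) :
    ¬ PerfectlyResilient G ρ t := by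
  set F' := F ∪ (G.incidenceSet u \ {s(v, u)}) with hF'
  intro hres
  have hsub : F' ⊆ G.edgeSet :=
    Set.union_subset hF fun _ hx => hx.1.1
  have heF' : s(v, u) ∉ F' := by simp [hF', heF]
  have hlocal : F ∩ G.incidenceSet v = F' ∩ G.incidenceSet v := by
    ext x
    refine ⟨fun hx => ⟨Or.inl hx.1, hx.2⟩, ?_⟩
    rintro ⟨hx | ⟨hxu, hxe⟩, hxv⟩
    · exact ⟨hx, hxv⟩
    · exact absurd ((Sym2.mem_and_mem_iff hadj.ne).1 ⟨hxv.2, hxu.2⟩) hxe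
  have hv (e : Sym2 V) : ρ F' v e = s(v, u) :=
    (hloc F hF F' hsub v hlocal e).symm.trans (hval e)
  have hu (e : Sym2 V) : ρ F' u e = s(v, u) ∨ ρ F' u e = s(u, u) := by
    obtain ⟨hmem, hactive⟩ := hρ F' hsub u e
    have hnot : ¬ G.incidenceSet u ⊆ F' := fun h =>
      heF' (h ⟨hadj, Sym2.mem_mk_right v u⟩)
    refine hmem.imp (fun hinc => ?_) id
    by_contra hne
    exact hactive hnot (Or.inr ⟨hinc, hne⟩)
  obtain ⟨n, hn⟩ := hres F' hsub v hreach
  have hmem := (route_mem (ρ := ρ) (F := F') (S := {v, u}) (s₀ := v) (by simp) (by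
    rintro w (rfl | rfl) e
    · simp [hv, step_mk_left]
    · rcases hu e with h | h
      · simp [h, Sym2.eq_swap (a := v), step_mk_left]
      · simp [h, step_mk_left]) n).1
  rw [hn] at hmem
  exact hmem.elim hvt.symm hut.symm
end

section
/- Let G = (V, E) be a finite connected simple graph in which every simple cycle has length at most 3, and let t ∈ V be any target vertex. Then there exists a skipping priority list whose lists do not depend on the in-port, such that the induced skipping forwarding pattern is in-port oblivious and perfectly resilient for t. -/
open Classical

namespace FRR

variable {V : Type*} {G : SimpleGraph V}

/-- `IsParent G t a b`: the vertex `b` is a neighbour of `a` one step closer to `t`. -/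
def IsParent (G : SimpleGraph V) (t a b : V) : Prop :=
  G.Adj a b ∧ G.dist b t + 1 = G.dist a t

lemma exists_isParent (hG : G.Connected) {t v : V} (hv : v ≠ t) : ∃ p, IsParent G t v p := by
  obtain ⟨w, hw⟩ := hG.exists_walk_length_eq_dist v t
  cases w with
  | nil => exact absurd rfl hv
  | @cons _ p _ h q =>
    refine ⟨p, h, ?_⟩
    have h₁ : G.dist p t ≤ q.length := G.dist_le q
    have h₂ : G.dist v t ≤ G.dist v p + G.dist p t := hG.dist_triangle
    rw [SimpleGraph.dist_eq_one_iff_adj.mpr h] at h₂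
    rw [SimpleGraph.Walk.length_cons] at hw
    omega

lemma exists_walk_support_dist_le (hG : G.Connected) (v t : V) :
    ∃ w : G.Walk v t, ∀ x ∈ w.support, G.dist x t ≤ G.dist v t := by
  obtain ⟨w, hw⟩ := hG.exists_walk_length_eq_dist v t
  refine ⟨w, fun x hx => ?_⟩
  have h₁ := G.dist_le (w.dropUntil x hx)
  have h₂ := w.length_dropUntil_le_length hx
  omega

/-- Balls around `t` are path-connected. -/
lemma exists_isPath_support_dist_le (hG : G.Connected) (t : V) {a b : V}
    (hab : G.dist a t = G.dist b t) :
    ∃ q : G.Walk a b, q.IsPath ∧ ∀ x ∈ q.support, G.dist x t ≤ G.dist a t := by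
  obtain ⟨w₁, h₁⟩ := exists_walk_support_dist_le hG a t
  obtain ⟨w₂, h₂⟩ := exists_walk_support_dist_le hG b t
  refine ⟨(w₁.append w₂.reverse).bypass, SimpleGraph.Walk.bypass_isPath _, fun x hx => ?_⟩
  have hx' := SimpleGraph.Walk.support_bypass_subset_support _ hx
  rw [SimpleGraph.Walk.mem_support_append_iff, SimpleGraph.Walk.support_reverse,
    List.mem_reverse] at hx'
  rcases hx' with hx' | hx'
  · exact h₁ x hx'
  · exact hab ▸ h₂ x hx'

/-- A path avoiding `u` between two distinct neighbours of `u` closes up to a cycle, so it is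
short. -/
lemma length_le_one_of_isPath
    (hcyc : ∀ (w : V) (c : G.Walk w w), c.IsCycle → c.length ≤ 3) {u a b : V}
    (q : G.Walk a b) (hq : q.IsPath) (hu : u ∉ q.support) (ha : G.Adj u a) (hb : G.Adj u b)
    (hab : a ≠ b) : q.length ≤ 1 := by
  have hc : (SimpleGraph.Walk.cons hb.symm (SimpleGraph.Walk.cons ha q)).IsCycle := by
    rw [SimpleGraph.Walk.cons_isCycle_iff, SimpleGraph.Walk.cons_isPath_iff]
    refine ⟨⟨hq, hu⟩, fun h => ?_⟩
    rw [SimpleGraph.Walk.edges_cons, List.mem_cons] at h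
    rcases h with h | h
    · rw [Sym2.eq_swap, Sym2.congr_right] at h
      exact hab h.symm
    · exact hu (q.snd_mem_support_of_mem_edges h)
  have := hcyc _ _ hc
  simp only [SimpleGraph.Walk.length_cons] at this
  omega

lemma eq_of_common_neighbors
    (hcyc : ∀ (w : V) (c : G.Walk w w), c.IsCycle → c.length ≤ 3) {u r a b : V}
    (hur : u ≠ r) (ha : G.Adj u a) (hb : G.Adj u b) (har : G.Adj a r) (hbr : G.Adj b r) :
    a = b := by
  by_contra hab
  have := length_le_one_of_isPath hcyc
    (SimpleGraph.Walk.cons har (SimpleGraph.Walk.cons hbr.symm SimpleGraph.Walk.nil))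
    (by simp [SimpleGraph.Walk.cons_isPath_iff, har.ne, hbr.ne', hab])
    (by simp [ha.ne, hb.ne, hur]) ha hb hab
  simp at this

/-- Adjacent vertices at the same distance from `t` have the same parent. -/
lemma IsParent.eq_of_adj (hG : G.Connected)
    (hcyc : ∀ (w : V) (c : G.Walk w w), c.IsCycle → c.length ≤ 3) {t v w p q : V}
    (hvw : G.Adj v w) (hd : G.dist v t = G.dist w t) (hp : IsParent G t v p)
    (hq : IsParent G t w q) : p = q := by
  have hp₂ := hp.2
  have hq₂ := hq.2
  obtain ⟨c, hc, hs⟩ := exists_isPath_support_dist_le hG t (a := p) (b := q) (by omega)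
  have hw : w ∉ c.support := fun h => by have := hs w h; omega
  have hv : v ∉ c.support := fun h => by have := hs v h; omega
  have hpw : p ≠ w := by rintro rfl; omega
  have := length_le_one_of_isPath hcyc (c.concat hq.1.symm) (hc.concat hw hq.1.symm)
    (by simp [SimpleGraph.Walk.support_concat, hv, hvw.ne]) hp.1 hvw hpw
  rw [SimpleGraph.Walk.length_concat] at this
  exact SimpleGraph.Walk.eq_of_length_eq_zero (p := c) (by omega)

lemma IsParent.unique (hG : G.Connected)
    (hcyc : ∀ (w : V) (c : G.Walk w w), c.IsCycle → c.length ≤ 3) {t v p q : V}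
    (hp : IsParent G t v p) (hq : IsParent G t v q) : p = q := by
  have hp₂ := hp.2
  have hq₂ := hq.2
  by_contra hpq
  obtain ⟨c, hc, hs⟩ := exists_isPath_support_dist_le hG t (a := p) (b := q) (by omega)
  have hv : v ∉ c.support := fun h => by have := hs v h; omega
  have hlen := length_le_one_of_isPath hcyc c hc hv hp.1 hq.1 hpq
  have hpos : c.length ≠ 0 := fun h => hpq (SimpleGraph.Walk.eq_of_length_eq_zero h)
  have hadj : G.Adj p q := SimpleGraph.Walk.adj_of_length_eq_one (p := c) (by omega)
  have hpt : p ≠ t := by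
    rintro rfl
    have : G.dist q p ≠ 0 := (hG.pos_dist_of_ne (Ne.symm hpq)).ne'
    rw [SimpleGraph.dist_self] at hp₂
    omega
  have hqt : q ≠ t := by
    rintro rfl
    have : G.dist p q ≠ 0 := (hG.pos_dist_of_ne hpq).ne'
    rw [SimpleGraph.dist_self] at hq₂
    omega
  obtain ⟨r, hr⟩ := exists_isParent hG hpt
  obtain ⟨r', hr'⟩ := exists_isParent hG hqt
  obtain rfl := hr.eq_of_adj hG hcyc hadj (by omega) hr'
  have hr₂ := hr.2
  exact hpq (eq_of_common_neighbors hcyc (by rintro rfl; omega) hp.1 hq.1 hr.1 hr'.1)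

lemma ne_target_of_dist_eq (hG : G.Connected) {t v w : V} (hv : v ≠ t)
    (hd : G.dist v t = G.dist w t) : w ≠ t := by
  rintro rfl
  have := hG.pos_dist_of_ne hv
  rw [SimpleGraph.dist_self] at hd
  omega

/-- A vertex has at most one neighbour at its own distance from `t`. -/
lemma eq_of_adj_of_dist_eq (hG : G.Connected)
    (hcyc : ∀ (w : V) (c : G.Walk w w), c.IsCycle → c.length ≤ 3) {t v w w' : V} (hv : v ≠ t)
    (hw : G.Adj v w) (hd : G.dist v t = G.dist w t)
    (hw' : G.Adj v w') (hd' : G.dist v t = G.dist w' t) : w = w' := by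
  obtain ⟨p, hp⟩ := exists_isParent hG hv
  obtain ⟨q, hq⟩ := exists_isParent hG (ne_target_of_dist_eq hG hv hd)
  obtain ⟨r, hr⟩ := exists_isParent hG (ne_target_of_dist_eq hG hv hd')
  obtain rfl := hp.eq_of_adj hG hcyc hw hd hq
  obtain rfl := hp.eq_of_adj hG hcyc hw' hd' hr
  exact eq_of_common_neighbors hcyc hp.1.ne hw hw' hq.1 hr.1

/-- The vertices whose chain of parents passes through `v`. -/
def descendants (G : SimpleGraph V) (t v : V) : Set V :=
  {x | Relation.ReflTransGen (IsParent G t) x v}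

lemma mem_descendants_self (t v : V) : v ∈ descendants G t v := Relation.ReflTransGen.refl

lemma dist_le_of_mem_descendants {t v x : V} (hx : x ∈ descendants G t v) :
    G.dist v t ≤ G.dist x t := by
  induction hx with
  | refl => exact le_rfl
  | tail _ h ih => have := h.2; omega

lemma target_notMem_descendants (hG : G.Connected) {t v : V} (hv : v ≠ t) :
    t ∉ descendants G t v := fun h => by
  have h₁ := dist_le_of_mem_descendants h
  have h₂ := hG.pos_dist_of_ne hv
  rw [SimpleGraph.dist_self] at h₁
  omega

lemma dist_le_succ_of_adj (hG : G.Connected) {x y : V} (t : V) (h : G.Adj x y) :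
    G.dist x t ≤ G.dist y t + 1 := by
  have := hG.dist_triangle (u := x) (v := y) (w := t)
  rw [SimpleGraph.dist_eq_one_iff_adj.mpr h] at this
  omega

/-- The descendants of `v` can only be left from `v` itself, towards a parent or a sibling. -/
lemma eq_and_dist_le_of_adj_of_notMem_descendants (hG : G.Connected)
    (hcyc : ∀ (w : V) (c : G.Walk w w), c.IsCycle → c.length ≤ 3) {t v x y : V} (hv : v ≠ t)
    (hx : x ∈ descendants G t v) (hy : y ∉ descendants G t v) (hxy : G.Adj x y) :
    x = v ∧ G.dist y t ≤ G.dist v t := by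
  have h₁ := dist_le_succ_of_adj hG t hxy
  have h₂ := dist_le_succ_of_adj hG t hxy.symm
  have hup : G.dist x t + 1 ≠ G.dist y t := fun h =>
    hy (Relation.ReflTransGen.head ⟨hxy.symm, h⟩ hx)
  rcases Relation.ReflTransGen.cases_head hx with rfl | ⟨p, hp, hpv⟩
  · exact ⟨rfl, by omega⟩
  · refine absurd ?_ hy
    rcases eq_or_ne (G.dist x t) (G.dist y t) with hd | hd
    · have hxt : x ≠ t := by
        rintro rfl
        exact target_notMem_descendants hG hv hx
      obtain ⟨q, hq⟩ := exists_isParent hG (ne_target_of_dist_eq hG hxt hd)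
      obtain rfl := hp.eq_of_adj hG hcyc hxy hd hq
      exact Relation.ReflTransGen.head hq hpv
    · obtain rfl := hp.unique hG hcyc (q := y) ⟨hxy, by omega⟩
      exact hpv

lemma exists_adj_boundary {H : SimpleGraph V} {v t : V} (h : H.Reachable v t) (S : Set V)
    (hv : v ∈ S) (ht : t ∉ S) : ∃ x ∈ S, ∃ y ∉ S, H.Adj x y := by
  obtain ⟨w⟩ := h
  obtain ⟨d, -, h₁, h₂⟩ := w.exists_boundary_dart S hv ht
  exact ⟨d.fst, h₁, d.snd, h₂, d.adj⟩

/-- Always moving to an `H`-neighbour closest to `t` in `G` gets strictly closer to `t`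
within two steps. -/
lemma dist_lt_or_dist_lt_of_reachable (hG : G.Connected)
    (hcyc : ∀ (w : V) (c : G.Walk w w), c.IsCycle → c.length ≤ 3) {H : SimpleGraph V}
    (hH : H ≤ G) {t : V} {nxt : V → V}
    (hnxt : ∀ v y, H.Adj v y → H.Adj v (nxt v) ∧ G.dist (nxt v) t ≤ G.dist y t)
    {v : V} (hv : v ≠ t) (hr : H.Reachable v t) :
    (H.Adj v (nxt v) ∧ G.dist (nxt v) t < G.dist v t) ∨
      (H.Adj v (nxt v) ∧ H.Adj (nxt v) (nxt (nxt v)) ∧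
        G.dist (nxt (nxt v)) t < G.dist v t) := by
  obtain ⟨x, hx, y, hy, hxy⟩ := exists_adj_boundary hr _ (mem_descendants_self t v)
    (target_notMem_descendants hG hv)
  obtain ⟨rfl, hd⟩ := eq_and_dist_le_of_adj_of_notMem_descendants hG hcyc hv hx hy (hH hxy)
  obtain ⟨hz, hzy⟩ := hnxt x y hxy
  rcases lt_or_eq_of_le (hzy.trans hd) with hlt | heq
  · exact Or.inl ⟨hz, hlt⟩
  refine Or.inr ⟨hz, ?_⟩
  have hzt := ne_target_of_dist_eq hG hv heq.symm
  obtain ⟨a, ha, b, hb, hab⟩ := exists_adj_boundary hr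
    (descendants G t x ∪ descendants G t (nxt x)) (Or.inl (mem_descendants_self t x))
    (fun h => h.elim (target_notMem_descendants hG hv) (target_notMem_descendants hG hzt))
  rw [Set.mem_union, not_or] at hb
  rcases ha with ha | ha
  · obtain ⟨rfl, hbd⟩ :=
      eq_and_dist_le_of_adj_of_notMem_descendants hG hcyc hv ha hb.1 (hH hab)
    have hba := (hnxt a b hab).2
    obtain rfl := eq_of_adj_of_dist_eq hG hcyc hv (hH hab) (by omega) (hH hz) heq.symm
    exact absurd (mem_descendants_self t _) hb.2
  · obtain ⟨rfl, hbd⟩ :=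
      eq_and_dist_le_of_adj_of_notMem_descendants hG hcyc hzt ha hb.2 (hH hab)
    have hbx : b ≠ x := by
      rintro rfl
      exact hb.1 (mem_descendants_self t _)
    have hne : G.dist b t ≠ G.dist (nxt x) t := fun h =>
      hbx (eq_of_adj_of_dist_eq hG hcyc hzt (hH hab) h.symm (hH hz.symm) heq)
    obtain ⟨h₁, h₂⟩ := hnxt _ b hab
    exact ⟨h₁, by omega⟩

lemma exists_iterate_eq_of_reachable (hG : G.Connected)
    (hcyc : ∀ (w : V) (c : G.Walk w w), c.IsCycle → c.length ≤ 3) {H : SimpleGraph V}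
    (hH : H ≤ G) {t : V} {nxt : V → V}
    (hnxt : ∀ v y, H.Adj v y → H.Adj v (nxt v) ∧ G.dist (nxt v) t ≤ G.dist y t)
    (v : V) (hr : H.Reachable v t) : ∃ n, nxt^[n] v = t := by
  induction hd : G.dist v t using Nat.strong_induction_on generalizing v with
  | _ d ih =>
    subst hd
    by_cases hv : v = t
    · exact ⟨0, hv⟩
    rcases dist_lt_or_dist_lt_of_reachable hG hcyc hH hnxt hv hr with
      ⟨h₁, hlt⟩ | ⟨h₁, h₂, hlt⟩
    · obtain ⟨n, hn⟩ := ih _ hlt _ (h₁.reachable.symm.trans hr) rfl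
      exact ⟨n + 1, hn⟩
    · obtain ⟨n, hn⟩ := ih _ hlt _ (h₂.reachable.symm.trans (h₁.reachable.symm.trans hr)) rfl
      exact ⟨n + 2, hn⟩

lemma route_eq_iterate {ρ : Fwd V} {F : Set (Sym2 V)} {nxt : V → V}
    (h : ∀ v e, step v (ρ F v e) = nxt v) (s : V) (n : ℕ) :
    (route ρ F s n).2 = nxt^[n] s := by
  induction n with
  | zero => rfl
  | succ n ih => rw [Function.iterate_succ_apply', ← ih, ← h]; rfl

lemma reaches_of_iterate_eq {ρ : Fwd V} {F : Set (Sym2 V)} {nxt : V → V}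
    (h : ∀ v e, step v (ρ F v e) = nxt v) {s t : V} {n : ℕ} (hn : nxt^[n] s = t) :
    Reaches ρ F s t :=
  ⟨n + 1, (route_eq_iterate h s n).trans hn⟩

lemma step_mk (v w : V) : step v s(v, w) = w := by
  have h : v ∈ s(v, w) := Sym2.mem_mk_left v w
  rw [step, dif_pos h]
  exact Sym2.congr_right.mp (Sym2.other_spec h)

/-- The links at `v`, sorted by the distance of their other endpoint to `t`. -/
noncomputable def sortedLinks [Finite V] (G : SimpleGraph V) (t v : V) : List (Sym2 V) :=
  (Set.toFinite (G.incidenceSet v)).toFinset.toList.mergeSort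
    (fun e f => decide (G.dist (step v e) t ≤ G.dist (step v f) t))

lemma isSkipList_sortedLinks [Finite V] (G : SimpleGraph V) (t : V) :
    IsSkipList G (fun v _ => sortedLinks G t v) := fun v _ =>
  ⟨(List.mergeSort_perm _ _).nodup_iff.mpr (Finset.nodup_toList _), fun f => by
    simp [sortedLinks]⟩

lemma pairwise_sortedLinks [Finite V] (G : SimpleGraph V) (t v : V) :
    (sortedLinks G t v).Pairwise
      (fun e f => G.dist (step v e) t ≤ G.dist (step v f) t) := by
  have := List.pairwise_mergeSort
    (le := fun e f => decide (G.dist (step v e) t ≤ G.dist (step v f) t))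
    (fun a b c hab hbc => by simp only [decide_eq_true_eq] at *; omega)
    (fun a b => by simp only [Bool.or_eq_true, decide_eq_true_eq]; omega)
    (Set.toFinite (G.incidenceSet v)).toFinset.toList
  simpa [sortedLinks] using this

/-- Skipping along the sorted links moves to an active neighbour closest to `t`. -/
lemma adj_step_skipFwd_sortedLinks [Finite V] (G : SimpleGraph V) (t : V) (F : Set (Sym2 V))
    (v y : V) (e : Sym2 V) (hy : (G.deleteEdges F).Adj v y) :
    (G.deleteEdges F).Adj v (step v (skipFwd (fun v _ => sortedLinks G t v) F v e)) ∧
      G.dist (step v (skipFwd (fun v _ => sortedLinks G t v) F v e)) t ≤ G.dist y t := by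
  rw [SimpleGraph.deleteEdges_adj] at hy
  have hmem := (isSkipList_sortedLinks G t v e).2
  have hym : s(v, y) ∈ sortedLinks G t v :=
    (hmem _).mpr ((G.mk'_mem_incidenceSet_left_iff).mpr hy.1)
  unfold skipFwd
  cases hf : (sortedLinks G t v).find? (fun f => decide (f ∉ F)) with
  | none =>
    rw [List.find?_eq_none] at hf
    exact absurd hy.2 (by simpa using hf _ hym)
  | some f =>
    obtain ⟨hfF, as, bs, hl, has⟩ := List.find?_eq_some_iff_append.mp hf
    have hfm := (hmem f).mp (List.mem_of_find?_eq_some hf)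
    obtain ⟨z, rfl⟩ := Sym2.mem_iff_exists.mp hfm.2
    rw [step_mk]
    refine ⟨SimpleGraph.deleteEdges_adj.mpr ⟨hfm.1, by simpa using hfF⟩, ?_⟩
    have hp := pairwise_sortedLinks G t v
    rw [hl] at hp hym
    rcases List.mem_append.mp hym with h | h
    · exact absurd hy.2 (by simpa using has _ h)
    · rcases List.mem_cons.mp h with h | h
      · rw [Sym2.congr_right.mp h]
      · simpa [step_mk] using List.rel_of_pairwise_cons (List.pairwise_append.mp hp).2.1 h

end FRR

open FRR in
/-- If every simple cycle of a finite connected simple graph `G` has length at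
most `3`, then for every target `t` there is a skipping priority list whose lists
do not depend on the in-port such that the induced skipping forwarding pattern is
in-port oblivious and perfectly resilient for `t`. -/
theorem exists_inport_oblivious_skipping_of_cycles_le_three {V : Type*} [Fintype V]
    (G : SimpleGraph V) (hG : G.Connected)
    (hcyc : ∀ (w : V) (c : G.Walk w w), c.IsCycle → c.length ≤ 3) (t : V) :
    ∃ L : V → Sym2 V → List (Sym2 V), IsSkipList G L ∧
      (∀ (v : V) (e e' : Sym2 V), L v e = L v e') ∧
      InPortOblivious G (skipFwd L) ∧
      PerfectlyResilient G (skipFwd L) t := by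
  refine ⟨fun v _ => sortedLinks G t v, isSkipList_sortedLinks G t, fun _ _ _ => rfl,
    fun _ _ _ _ _ => rfl, fun F _ v hr => ?_⟩
  obtain ⟨n, hn⟩ := exists_iterate_eq_of_reachable hG hcyc (G.deleteEdges_le F)
    (fun v y hy => adj_step_skipFwd_sortedLinks G t F v y s(v, v) hy) v hr
  exact reaches_of_iterate_eq (fun _ _ => rfl) hn
end
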